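/- Let n ≥ 1, s ≥ 1, let a ∈ ℂ^n, and set f = q_n^{[s]} − (a·x)^{[2s]} where q_n^{[s]} = q_n^s/(2^s s!) and (a·x)^{[2s]} = (a·x)^{2s}/(2s)!. Then the rank (dimension of the image) of the middle catalecticant map Cat_{f,s} satisfies T_{n,s} − 1 ≤ rk(Cat_{f,s}) ≤ T_{n,s}, where T_{n,s} = binom(s+n−1, s). -/

import Mathlib

open MvPolynomial

noncomputable def qpoly (n : ℕ) : MvPolynomial (Fin n) ℂ :=
  ∑ i : Fin n, X i ^ 2

noncomputable def linForm {n : ℕ} (a : Fin n → ℂ) : MvPolynomial (Fin n) ℂ :=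
  ∑ i : Fin n, C (a i) * X i

noncomputable def dotC {n : ℕ} (a b : Fin n → ℂ) : ℂ :=
  ∑ i : Fin n, a i * b i

noncomputable def diffOp {n : ℕ} (φ f : MvPolynomial (Fin n) ℂ) : MvPolynomial (Fin n) ℂ :=
  ∑ d ∈ φ.support, φ.coeff d •
    ((List.ofFn fun i : Fin n =>
        ((pderiv i).toLinearMap : MvPolynomial (Fin n) ℂ →ₗ[ℂ] MvPolynomial (Fin n) ℂ) ^ d i).prod f)

noncomputable def lap {n : ℕ} (f : MvPolynomial (Fin n) ℂ) : MvPolynomial (Fin n) ℂ :=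
  ∑ i : Fin n, pderiv i (pderiv i f)

noncomputable def catRank (n j : ℕ) (f : MvPolynomial (Fin n) ℂ) : ℕ :=
  Module.finrank ℂ
    (Submodule.span ℂ ((fun φ => diffOp φ f) '' {φ : MvPolynomial (Fin n) ℂ | φ.IsHomogeneous j}))

section Monomials

theorem List.prod_ofFn_pow_add_single {M : Type*} [Monoid M] {n : ℕ} (P : Fin n → M)
    (hP : ∀ i j, Commute (P i) (P j)) (d e : Fin n → ℕ) (i : Fin n)
    (he : ∀ j, e j = d j + if j = i then 1 else 0) :
    (List.ofFn fun j => P j ^ e j).prod = P i * (List.ofFn fun j => P j ^ d j).prod := by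
  induction n with
  | zero => exact i.elim0
  | succ n ih =>
    simp only [List.ofFn_succ, List.prod_cons]
    induction i using Fin.cases with
    | zero =>
      have h0 : e 0 = d 0 + 1 := by simp [he]
      have hs : ∀ j : Fin n, e j.succ = d j.succ := fun j => by simp [he, Fin.succ_ne_zero]
      simp only [h0, hs, pow_succ', mul_assoc]
    | succ i =>
      have h0 : e 0 = d 0 := by simp [he, (Fin.succ_ne_zero i).symm]
      rw [h0, ih (fun j => P j.succ) (fun _ _ => hP _ _) (fun j => d j.succ)
        (fun j => e j.succ) i (fun j => by simp [he]), ← mul_assoc, ← mul_assoc,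
        ((hP 0 i.succ).pow_left _).eq]

theorem Finsupp.induction_add_single {σ : Type*} {p : (σ →₀ ℕ) → Prop} (zero : p 0)
    (add_single : ∀ d i, p d → p (d + Finsupp.single i 1)) (d : σ →₀ ℕ) : p d := by
  classical
  have key : ∀ m : Multiset σ, p (Multiset.toFinsupp m) := by
    intro m
    induction m using Multiset.induction_on with
    | empty => simpa using zero
    | cons a m ih =>
      rw [← Multiset.singleton_add, map_add, add_comm, Multiset.toFinsupp_singleton]
      exact add_single _ _ ih
  simpa using key (Finsupp.toMultiset d)

end Monomials

section Apolarity

variable {n : ℕ}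

theorem MvPolynomial.pderiv_pderiv_comm {σ R : Type*} [CommSemiring R] (i j : σ)
    (f : MvPolynomial σ R) :
    pderiv i (pderiv j f) = pderiv j (pderiv i f) := by
  classical
  ext d
  simp only [coeff_pderiv]
  rw [add_right_comm]
  by_cases h : i = j
  · subst h; rfl
  · simp [h, Ne.symm h]
    ring

/-- The iterated partial derivative with multi-index `d`. -/
noncomputable def iterPderiv (d : Fin n →₀ ℕ) :
    MvPolynomial (Fin n) ℂ →ₗ[ℂ] MvPolynomial (Fin n) ℂ :=
  (List.ofFn fun i : Fin n =>
    ((pderiv i).toLinearMap : MvPolynomial (Fin n) ℂ →ₗ[ℂ] MvPolynomial (Fin n) ℂ) ^ d i).prod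

theorem iterPderiv_zero (f : MvPolynomial (Fin n) ℂ) : iterPderiv 0 f = f := by
  simp [iterPderiv, List.ofFn_const]

theorem iterPderiv_add_single (d : Fin n →₀ ℕ) (i : Fin n) (f : MvPolynomial (Fin n) ℂ) :
    iterPderiv (d + Finsupp.single i 1) f = pderiv i (iterPderiv d f) := by
  unfold iterPderiv
  rw [List.prod_ofFn_pow_add_single (fun i : Fin n =>
    ((pderiv i).toLinearMap : Module.End ℂ (MvPolynomial (Fin n) ℂ))) _ d _ i]
  · rfl
  · intro j
    simp [Finsupp.single_apply, eq_comm]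
  · intro i j
    exact LinearMap.ext fun f => pderiv_pderiv_comm i j f

/-- The catalecticant of `f` on polynomials of all degrees, as a linear map. -/
noncomputable def apolarMap (f : MvPolynomial (Fin n) ℂ) :
    MvPolynomial (Fin n) ℂ →ₗ[ℂ] MvPolynomial (Fin n) ℂ :=
  (basisMonomials (Fin n) ℂ).constr ℂ fun d => iterPderiv d f

theorem apolarMap_monomial (f : MvPolynomial (Fin n) ℂ) (d : Fin n →₀ ℕ) (c : ℂ) :
    apolarMap f (monomial d c) = c • iterPderiv d f := by
  have h : (monomial d c : MvPolynomial (Fin n) ℂ) = c • basisMonomials (Fin n) ℂ d := by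
    simp [smul_monomial]
  rw [h, map_smul, apolarMap, Module.Basis.constr_basis]

theorem apolarMap_apply (f φ : MvPolynomial (Fin n) ℂ) :
    apolarMap f φ = ∑ d ∈ φ.support, φ.coeff d • iterPderiv d f := by
  conv_lhs => rw [φ.as_sum, map_sum]
  simp only [apolarMap_monomial]

theorem diffOp_eq_apolarMap (φ f : MvPolynomial (Fin n) ℂ) : diffOp φ f = apolarMap f φ :=
  (apolarMap_apply f φ).symm

theorem apolarMap_smul_sub_smul (b c : ℂ) (f g φ : MvPolynomial (Fin n) ℂ) :
    apolarMap (b • f - c • g) φ = b • apolarMap f φ - c • apolarMap g φ := by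
  simp only [apolarMap_apply, map_sub, map_smul, smul_sub, Finset.sum_sub_distrib,
    Finset.smul_sum, smul_comm b, smul_comm c]

theorem catRank_eq_finrank_map (j : ℕ) (f : MvPolynomial (Fin n) ℂ) :
    catRank n j f =
      Module.finrank ℂ ((homogeneousSubmodule (Fin n) ℂ j).map (apolarMap f)) := by
  have h : (fun φ => diffOp φ f) = apolarMap f := funext fun φ => diffOp_eq_apolarMap φ f
  rw [catRank, h, ← Submodule.span_eq (homogeneousSubmodule (Fin n) ℂ j), Submodule.map_span]
  rfl

/-- The Fischer inner product with `ψ`, conjugate-linear in `ψ`. -/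
noncomputable def fischer (ψ : MvPolynomial (Fin n) ℂ) : MvPolynomial (Fin n) ℂ →ₗ[ℂ] ℂ :=
  (basisMonomials (Fin n) ℂ).constr ℂ fun d =>
    ((∏ i, (d i).factorial : ℕ) : ℂ) * star (ψ.coeff d)

theorem fischer_monomial (ψ : MvPolynomial (Fin n) ℂ) (d : Fin n →₀ ℕ) (c : ℂ) :
    fischer ψ (monomial d c) = c * (((∏ i, (d i).factorial : ℕ) : ℂ) * star (ψ.coeff d)) := by
  have h : (monomial d c : MvPolynomial (Fin n) ℂ) = c • basisMonomials (Fin n) ℂ d := by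
    simp [smul_monomial]
  rw [h, map_smul, fischer, Module.Basis.constr_basis, smul_eq_mul]

theorem fischer_self (φ : MvPolynomial (Fin n) ℂ) :
    fischer φ φ =
      ((∑ d ∈ φ.support, (∏ i, (d i).factorial : ℕ) * ‖φ.coeff d‖ ^ 2 : ℝ) : ℂ) := by
  conv_lhs => rw [φ.as_sum, map_sum]
  push_cast
  refine Finset.sum_congr rfl fun d _ => ?_
  rw [← φ.as_sum, fischer_monomial, ← Complex.mul_conj', starRingEnd_apply]
  push_cast
  ring

theorem fischer_self_re_nonneg (φ : MvPolynomial (Fin n) ℂ) : 0 ≤ (fischer φ φ).re := by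
  rw [fischer_self, Complex.ofReal_re]
  positivity

theorem eq_zero_of_fischer_self_re_le (φ : MvPolynomial (Fin n) ℂ)
    (h : (fischer φ φ).re ≤ 0) : φ = 0 := by
  rw [fischer_self, Complex.ofReal_re] at h
  by_contra hφ
  refine h.not_gt (Finset.sum_pos (fun d hd => ?_) (support_nonempty.mpr hφ))
  have h1 : 0 < ∏ i, (d i).factorial := Finset.prod_pos fun i _ => Nat.factorial_pos _
  have h2 : 0 < ‖φ.coeff d‖ := norm_pos_iff.mpr (mem_support_iff.mp hd)
  positivity

theorem prod_factorial_add_single (d : Fin n →₀ ℕ) (i : Fin n) :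
    ∏ j, ((d + Finsupp.single i 1 : Fin n →₀ ℕ) j).factorial =
      (d i + 1) * ∏ j, (d j).factorial := by
  rw [← Finset.mul_prod_erase _ _ (Finset.mem_univ i),
    ← Finset.mul_prod_erase _ (fun j => (d j).factorial) (Finset.mem_univ i), ← mul_assoc]
  congr 1
  · simp [Nat.factorial_succ]
  · refine Finset.prod_congr rfl fun j hj => ?_
    simp [(Finset.ne_of_mem_erase hj).symm]

theorem fischer_X_mul (i : Fin n) (φ ψ : MvPolynomial (Fin n) ℂ) :
    fischer ψ (X i * φ) = fischer (pderiv i ψ) φ := by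
  conv_lhs => rw [φ.as_sum, Finset.mul_sum, map_sum]
  conv_rhs => rw [φ.as_sum, map_sum]
  refine Finset.sum_congr rfl fun d _ => ?_
  rw [X, monomial_mul, one_mul, add_comm, fischer_monomial, fischer_monomial,
    prod_factorial_add_single, coeff_pderiv]
  push_cast
  simp only [star_mul', star_add, star_natCast, star_one]
  ring

theorem lap_add (f g : MvPolynomial (Fin n) ℂ) : lap (f + g) = lap f + lap g := by
  simp [lap, Finset.sum_add_distrib]

theorem lap_smul (c : ℂ) (f : MvPolynomial (Fin n) ℂ) : lap (c • f) = c • lap f := by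
  simp [lap, Finset.smul_sum]

/-- The Laplacian as a linear map. -/
noncomputable def lapLin : Module.End ℂ (MvPolynomial (Fin n) ℂ) where
  toFun := lap
  map_add' := lap_add
  map_smul' := lap_smul

theorem lapLin_apply (f : MvPolynomial (Fin n) ℂ) :
    lapLin f = ∑ i : Fin n, pderiv i (pderiv i f) := rfl

theorem fischer_qpoly_pow_mul (k : ℕ) (φ ψ : MvPolynomial (Fin n) ℂ) :
    fischer ψ (qpoly n ^ k * φ) = fischer ((lapLin ^ k) ψ) φ := by
  have hadd : ∀ χ (v : Fin n → MvPolynomial (Fin n) ℂ),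
      fischer (∑ i, v i) χ = ∑ i, fischer (v i) χ := by
    intro χ v
    rw [χ.as_sum]
    simp only [map_sum, fischer_monomial, coeff_sum, star_sum, Finset.mul_sum]
    exact Finset.sum_comm
  induction k generalizing ψ with
  | zero => simp
  | succ k ih =>
    rw [pow_succ', mul_assoc, pow_succ, Module.End.mul_apply, ← ih, lapLin_apply, hadd, qpoly,
      Finset.sum_mul, map_sum]
    refine Finset.sum_congr rfl fun i _ => ?_
    rw [pow_two, mul_assoc, fischer_X_mul, fischer_X_mul]

theorem lapLin_X_mul (i : Fin n) (f : MvPolynomial (Fin n) ℂ) :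
    lapLin (X i * f) = X i * lapLin f + 2 * pderiv i f := by
  have h : ∀ j, pderiv j (pderiv j (X i * f)) =
      X i * pderiv j (pderiv j f) + if j = i then 2 * pderiv i f else 0 := by
    intro j
    by_cases hj : j = i
    · subst hj
      simp only [pderiv_mul, pderiv_X_self, map_add, one_mul, if_true]
      ring
    · simp [pderiv_X_of_ne (Ne.symm hj), hj]
  simp only [lapLin_apply, h, Finset.sum_add_distrib, Finset.mul_sum, Finset.sum_ite_eq',
    Finset.mem_univ, if_true]

theorem pderiv_lapLin (i : Fin n) (f : MvPolynomial (Fin n) ℂ) :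
    pderiv i (lapLin f) = lapLin (pderiv i f) := by
  simp only [lapLin_apply, map_sum]
  refine Finset.sum_congr rfl fun j _ => ?_
  rw [pderiv_pderiv_comm i j, pderiv_pderiv_comm i j]

theorem lapLin_pow_succ_X_mul (k : ℕ) (i : Fin n) (f : MvPolynomial (Fin n) ℂ) :
    (lapLin ^ (k + 1)) (X i * f) =
      X i * (lapLin ^ (k + 1)) f + (2 * (k + 1) : ℂ) • pderiv i ((lapLin ^ k) f) := by
  induction k with
  | zero => simp [lapLin_X_mul, MvPolynomial.smul_eq_C_mul, map_ofNat C 2]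
  | succ k ih =>
    rw [pow_succ', Module.End.mul_apply, ih, map_add, lapLin_X_mul, map_smul, ← pderiv_lapLin,
      ← Module.End.mul_apply, ← Module.End.mul_apply, ← pow_succ', ← pow_succ']
    simp only [MvPolynomial.smul_eq_C_mul, map_mul, map_add, map_natCast, map_one, map_ofNat,
      Nat.cast_add, Nat.cast_one]
    ring

/-- The divided power `Δ ^ k / (2 ^ k k!)` of half the Laplacian. -/
noncomputable def dividedLap (k : ℕ) : Module.End ℂ (MvPolynomial (Fin n) ℂ) :=
  ((2 : ℂ) ^ k * (k.factorial : ℂ))⁻¹ • lapLin ^ k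

theorem dividedLap_succ_X_mul (k : ℕ) (i : Fin n) (f : MvPolynomial (Fin n) ℂ) :
    dividedLap (k + 1) (X i * f) = X i * dividedLap (k + 1) f + pderiv i (dividedLap k f) := by
  simp only [dividedLap, LinearMap.smul_apply, lapLin_pow_succ_X_mul, Derivation.map_smul, smul_add,
    smul_smul, mul_smul_comm]
  congr 2
  have : (k.factorial : ℂ) ≠ 0 := by exact_mod_cast k.factorial_ne_zero
  have : (k + 1 : ℂ) ≠ 0 := by exact_mod_cast k.succ_ne_zero
  rw [Nat.factorial_succ]
  push_cast
  field_simp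
  ring

theorem dividedLap_zero (f : MvPolynomial (Fin n) ℂ) : dividedLap 0 f = f := by
  simp [dividedLap]

/-- The divided power `q_n ^ m / (2 ^ m m!)`, extended by zero to negative `m`. -/
noncomputable def dividedQ (n : ℕ) : ℤ → MvPolynomial (Fin n) ℂ
  | (m : ℕ) => ((2 : ℂ) ^ m * (m.factorial : ℂ))⁻¹ • qpoly n ^ m
  | Int.negSucc _ => 0

theorem dividedQ_natCast (m : ℕ) :
    dividedQ n m = ((2 : ℂ) ^ m * (m.factorial : ℂ))⁻¹ • qpoly n ^ m := rfl

theorem pderiv_qpoly (i : Fin n) : pderiv i (qpoly n) = (2 : ℂ) • X i := by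
  have h : ∀ j : Fin n, pderiv i (X j ^ 2 : MvPolynomial (Fin n) ℂ) =
      if j = i then (2 : ℂ) • X i else 0 := by
    intro j
    by_cases hj : j = i
    · subst hj
      simp [MvPolynomial.smul_eq_C_mul, map_ofNat C 2]
    · simp [pderiv_X_of_ne hj, hj]
  simp [qpoly, h]

theorem pderiv_dividedQ (i : Fin n) (m : ℤ) :
    pderiv i (dividedQ n m) = X i * dividedQ n (m - 1) := by
  rcases m with (_ | m) | m
  · have h : dividedQ n (Int.ofNat 0 - 1) = 0 := rfl
    rw [h]
    simp [dividedQ]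
  · have h : Int.ofNat (m + 1) - 1 = (m : ℤ) := by simp
    rw [h]
    simp only [Int.ofNat_eq_natCast, dividedQ_natCast, Derivation.map_smul, pderiv_pow, pderiv_qpoly,
      Nat.add_sub_cancel]
    simp only [MvPolynomial.smul_eq_C_mul]
    have h2 : (C ((2 : ℂ) ^ m * (m.factorial : ℂ))⁻¹ : MvPolynomial (Fin n) ℂ) =
        C ((2 : ℂ) ^ (m + 1) * ((m + 1).factorial : ℂ))⁻¹ * (((m + 1 : ℕ) : MvPolynomial (Fin n) ℂ) * C 2) := by
      rw [← map_natCast (C : ℂ →+* MvPolynomial (Fin n) ℂ), ← map_mul, ← map_mul]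
      congr 1
      have : (m.factorial : ℂ) ≠ 0 := by exact_mod_cast m.factorial_ne_zero
      have : (m + 1 : ℂ) ≠ 0 := by exact_mod_cast m.succ_ne_zero
      rw [Nat.factorial_succ]
      push_cast
      field_simp
      ring
    rw [h2]
    ring
  · have h : Int.negSucc m - 1 = Int.negSucc (m + 1) := rfl
    simp [h, dividedQ]

theorem dividedLap_monomial_eq_zero (d : Fin n →₀ ℕ) :
    ∀ k, d.degree < k → dividedLap k (monomial d (1 : ℂ)) = 0 := by
  induction d using Finsupp.induction_add_single with
  | zero =>
    intro k hk
    obtain ⟨k, rfl⟩ := Nat.exists_eq_succ_of_ne_zero hk.ne_bot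
    simp [dividedLap, pow_succ, lapLin_apply]
  | add_single d i ih =>
    intro k hk
    rw [map_add, Finsupp.degree_single] at hk
    obtain ⟨k, rfl⟩ := Nat.exists_eq_succ_of_ne_zero hk.ne_bot
    have h : monomial (d + Finsupp.single i 1) (1 : ℂ) = X i * monomial d 1 := by
      rw [X, monomial_mul, one_mul, add_comm]
    rw [h, dividedLap_succ_X_mul, ih k (by omega), ih (k + 1) (by omega)]
    simp

theorem iterPderiv_dividedQ (d : Fin n →₀ ℕ) (m : ℤ) :
    iterPderiv d (dividedQ n m) = ∑ k ∈ Finset.range (d.degree + 1),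
      dividedLap k (monomial d 1) * dividedQ n (m - d.degree + k) := by
  induction d using Finsupp.induction_add_single with
  | zero => simp [iterPderiv_zero, dividedLap_zero]
  | add_single d i ih =>
    have h : monomial (d + Finsupp.single i 1) (1 : ℂ) = X i * monomial d 1 := by
      rw [X, monomial_mul, one_mul, add_comm]
    rw [iterPderiv_add_single, ih, map_sum, map_add, Finsupp.degree_single,
      Finset.sum_range_succ' _ (d.degree + 1), h]
    simp only [dividedLap_succ_X_mul, dividedLap_zero, pderiv_mul, pderiv_dividedQ, add_mul,
      Finset.sum_add_distrib]
    have h1 : ∑ k ∈ Finset.range (d.degree + 1),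
          dividedLap k (monomial d 1) * (X i * dividedQ n (m - d.degree + k - 1)) =
        ∑ k ∈ Finset.range (d.degree + 1), X i * dividedLap (k + 1) (monomial d 1) *
            dividedQ n (m - (d.degree + 1 : ℕ) + (k + 1 : ℕ)) +
          X i * monomial d 1 * dividedQ n (m - (d.degree + 1 : ℕ) + (0 : ℕ)) := by
      rw [Finset.sum_range_succ (fun k => X i * dividedLap (k + 1) (monomial d 1) * _),
        dividedLap_monomial_eq_zero d _ (Nat.lt_succ_self _), mul_zero, zero_mul, add_zero,
        Finset.sum_range_succ', dividedLap_zero]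
      congr 1
      · refine Finset.sum_congr rfl fun k _ => ?_
        rw [mul_left_comm, mul_assoc]
        congr 4
        push_cast
        ring
      · rw [mul_left_comm, mul_assoc]
        congr 4
        push_cast
        ring
    rw [h1, ← add_assoc, add_left_inj, add_comm, add_right_inj]
    refine Finset.sum_congr rfl fun k _ => ?_
    congr 2
    push_cast
    ring

theorem apolarMap_dividedQ {s : ℕ} {φ : MvPolynomial (Fin n) ℂ} (hφ : φ.IsHomogeneous s) :
    apolarMap (dividedQ n s) φ =
      ∑ k ∈ Finset.range (s + 1), dividedLap k φ * dividedQ n k := by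
  have h : ∀ k, dividedLap k φ * dividedQ n k =
      ∑ d ∈ φ.support, φ.coeff d • (dividedLap k (monomial d 1) * dividedQ n k) := by
    intro k
    conv_lhs => rw [φ.as_sum, map_sum, Finset.sum_mul]
    refine Finset.sum_congr rfl fun d _ => ?_
    rw [← smul_mul_assoc, ← map_smul, smul_monomial, smul_eq_mul, mul_one]
  simp only [h]
  rw [Finset.sum_comm, apolarMap_apply]
  refine Finset.sum_congr rfl fun d hd => ?_
  have hs : d.degree = s := by
    rw [Finsupp.degree_eq_weight_one]
    exact hφ (mem_support_iff.mp hd)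
  rw [iterPderiv_dividedQ, Finset.smul_sum, hs]
  simp

theorem eq_zero_of_apolarMap_dividedQ_eq_zero {s : ℕ} {φ : MvPolynomial (Fin n) ℂ}
    (hφ : φ.IsHomogeneous s) (h : apolarMap (dividedQ n s) φ = 0) : φ = 0 := by
  refine eq_zero_of_fischer_self_re_le φ ?_
  have hk : ∀ k : ℕ, fischer φ (dividedLap k φ * dividedQ n k) =
      ((((2 : ℝ) ^ k * (k.factorial : ℝ))⁻¹ ^ 2 : ℝ) : ℂ) *
        fischer ((lapLin ^ k) φ) ((lapLin ^ k) φ) := by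
    intro k
    rw [dividedQ_natCast, dividedLap, LinearMap.smul_apply, smul_mul_smul_comm, map_smul,
      mul_comm ((lapLin ^ k) φ), fischer_qpoly_pow_mul, smul_eq_mul]
    push_cast
    ring
  have hre : ∀ k : ℕ, 0 ≤ (fischer φ (dividedLap k φ * dividedQ n k)).re := by
    intro k
    rw [hk, Complex.re_ofReal_mul]
    exact mul_nonneg (by positivity) (fischer_self_re_nonneg _)
  have h0 : (fischer φ (dividedLap 0 φ * dividedQ n (0 : ℕ))).re = (fischer φ φ).re := by
    rw [hk]
    simp
  calc (fischer φ φ).re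
      ≤ ∑ k ∈ Finset.range (s + 1), (fischer φ (dividedLap k φ * dividedQ n k)).re := by
        rw [← h0]
        exact Finset.single_le_sum
          (f := fun k : ℕ => (fischer φ (dividedLap k φ * dividedQ n k)).re)
          (fun k _ => hre k) (Finset.mem_range.mpr s.succ_pos)
    _ = (fischer φ (apolarMap (dividedQ n s) φ)).re := by
        rw [apolarMap_dividedQ hφ, map_sum, Complex.re_sum]
    _ ≤ 0 := by simp [h]

theorem iterPderiv_linForm_pow_mem (a : Fin n → ℂ) (p : ℕ) (d : Fin n →₀ ℕ) :
    iterPderiv d (linForm a ^ p) ∈ Submodule.span ℂ {linForm a ^ (p - d.degree)} := by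
  induction d using Finsupp.induction_add_single with
  | zero => simp [iterPderiv_zero, Submodule.mem_span_singleton_self]
  | add_single d i ih =>
    obtain ⟨c, hc⟩ := Submodule.mem_span_singleton.mp ih
    have hi : pderiv i (linForm a) = C (a i) := by
      classical
      simp [linForm, pderiv_X, Pi.single_apply]
    rw [iterPderiv_add_single, ← hc, Derivation.map_smul, pderiv_pow, hi, map_add, Finsupp.degree_single,
      ← Nat.sub_sub]
    refine Submodule.smul_mem _ _ (Submodule.mem_span_singleton.mpr
      ⟨((p - d.degree : ℕ) : ℂ) * a i, ?_⟩)
    rw [MvPolynomial.smul_eq_C_mul, map_mul, map_natCast]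
    ring

theorem apolarMap_linForm_pow_mem (a : Fin n → ℂ) (p s : ℕ) {φ : MvPolynomial (Fin n) ℂ}
    (hφ : φ.IsHomogeneous s) :
    apolarMap (linForm a ^ p) φ ∈ Submodule.span ℂ {linForm a ^ (p - s)} := by
  rw [apolarMap_apply]
  refine Submodule.sum_mem _ fun d hd => Submodule.smul_mem _ _ ?_
  have hs : d.degree = s := by
    rw [Finsupp.degree_eq_weight_one]
    exact hφ (mem_support_iff.mp hd)
  exact hs ▸ iterPderiv_linForm_pow_mem a p d

end Apolarity

theorem MvPolynomial.finrank_homogeneousSubmodule (K : Type*) [Field K] (n s : ℕ) :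
    Module.finrank K (homogeneousSubmodule (Fin n) K s) = (s + n - 1).choose s := by
  classical
  have hset : {d : Fin n →₀ ℕ | d.degree = s} =
      (Finset.finsuppAntidiag (Finset.univ : Finset (Fin n)) s : Set (Fin n →₀ ℕ)) := by
    ext d
    simp [Finset.mem_finsuppAntidiag, Finsupp.degree_eq_sum]
  rw [homogeneousSubmodule_eq_finsupp_supported, hset,
    (AddMonoidAlgebra.supportedEquivFinsupp _).finrank_eq, Module.finrank_finsupp_self,
    ← Nat.card_eq_fintype_card, Nat.card_coe_set_eq, Set.ncard_coe_finset,
    Finset.card_finsuppAntidiag_nat_eq_choose, Finset.card_univ,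
    Fintype.card_fin, add_comm]

theorem LinearMap.finrank_le_finrank_map_add_one {K V W : Type*} [Field K] [AddCommGroup V]
    [Module K V] [AddCommGroup W] [Module K W] (A T : V →ₗ[K] W) (U : Submodule K V)
    [FiniteDimensional K U] (w : W) (hA : ∀ v ∈ U, A v = 0 → v = 0)
    (hAT : ∀ v ∈ U, A v - T v ∈ Submodule.span K {w}) :
    Module.finrank K U ≤ Module.finrank K (U.map T) + 1 := by
  have h1 := LinearMap.finrank_range_add_finrank_ker (T.domRestrict U)
  rw [LinearMap.range_domRestrict] at h1
  let g : LinearMap.ker (T.domRestrict U) →ₗ[K] Submodule.span K {w} :=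
    ((A.domRestrict U).domRestrict _).codRestrict _ fun v => by
      have hv : T (v : U) = 0 := v.2
      have := hAT _ v.1.2
      rwa [hv, sub_zero] at this
  have hg : Function.Injective g := by
    rw [← LinearMap.ker_eq_bot, LinearMap.ker_eq_bot']
    intro v hv
    exact Subtype.ext (Subtype.ext (hA _ v.1.2 (congrArg Subtype.val hv)))
  have h2 := LinearMap.finrank_le_finrank_of_injective hg
  have h3 : Module.finrank K (Submodule.span K {w}) ≤ 1 := by
    simpa using finrank_span_le_card (R := K) ({w} : Set W)
  omega

/-- For f = q_n^{[s]} − (a·x)^{[2s]}, the rank of the middle catalecticant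
satisfies T_{n,s} − 1 ≤ rk(Cat_{f,s}) ≤ T_{n,s}, where T_{n,s} = binom(s+n−1, s). -/
theorem middle_catalecticant_rank_sub_one_power (n s : ℕ) (hn : 1 ≤ n) (hs : 1 ≤ s)
    (a : Fin n → ℂ) (f : MvPolynomial (Fin n) ℂ)
    (hf : f = ((2 : ℂ) ^ s * (Nat.factorial s : ℂ))⁻¹ • qpoly n ^ s -
        ((Nat.factorial (2 * s) : ℂ))⁻¹ • linForm a ^ (2 * s)) :
    (s + n - 1).choose s - 1 ≤ catRank n s f ∧ catRank n s f ≤ (s + n - 1).choose s := by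
  subst hf
  have : FiniteDimensional ℂ (homogeneousSubmodule (Fin n) ℂ s) :=
    Module.Finite.iff_fg.mpr (homogeneousSubmodule_fg _ _ s)
  rw [catRank_eq_finrank_map, ← finrank_homogeneousSubmodule ℂ n s]
  refine ⟨Nat.sub_le_iff_le_add.mpr ?_, Submodule.finrank_map_le _ _⟩
  refine LinearMap.finrank_le_finrank_map_add_one (apolarMap (dividedQ n s)) _ _
    (linForm a ^ (2 * s - s)) (fun φ hφ => eq_zero_of_apolarMap_dividedQ_eq_zero hφ)
    fun φ hφ => ?_
  have hq : apolarMap (dividedQ n s) φ =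
      ((2 : ℂ) ^ s * (Nat.factorial s : ℂ))⁻¹ • apolarMap (qpoly n ^ s) φ := by
    simpa [dividedQ_natCast] using apolarMap_smul_sub_smul
      ((2 : ℂ) ^ s * (Nat.factorial s : ℂ))⁻¹ 0 (qpoly n ^ s) 0 φ
  rw [apolarMap_smul_sub_smul, hq, sub_sub_cancel]
  exact Submodule.smul_mem _ _ (apolarMap_linForm_pow_mem a (2 * s) s hφ)
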